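/- Let (h, q, q₁, q₂, q₃) be a smooth solution of the relaxed Serre–Green–Naghdi system with h > 0 on the closure of a bounded box D ⊂ ℝ^d times [0, T], with ε constant in space and time, and suppose the boundary flux vanishes: F_ε(u)·n = 0 on ∂D for all t ∈ (0, T), where F_ε := v(E_ε − (1/2)g z² + p_ε) and E_ε := (1/2)g(h+z)² + (1/2)h|v|² + (1/6)h ω² + (1/8)h β² + (λ̄ g/(3ε)) h³ Γ(η/h). Then ∫_D h³ Γ(η/h) dx evaluated at t = T is bounded by c(u₀) ε, where c(u₀) := (3/(λ̄ g)) ∫_D E_ε(·, 0) dx. -/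

import Mathlib

noncomputable section
open scoped BigOperators

/-- Physical space `ℝ^d`. -/
abbrev Spc (d : ℕ) := EuclideanSpace ℝ (Fin d)
/-- Space-time `ℝ^d × ℝ` (time is the second component). -/
abbrev SpT (d : ℕ) := Spc d × ℝ

/-- Time derivative `∂_t f`. -/
noncomputable def dT {d : ℕ} (f : SpT d → ℝ) (p : SpT d) : ℝ :=
  deriv (fun t => f (p.1, t)) p.2

/-- `i`-th spatial partial derivative `∂_i f` of a space-time function. -/
noncomputable def dX {d : ℕ} (i : Fin d) (f : SpT d → ℝ) (p : SpT d) : ℝ :=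
  fderiv ℝ (fun x => f (x, p.2)) p.1 (EuclideanSpace.single i 1)

/-- `i`-th spatial partial derivative `∂_i z` of a time-independent function. -/
noncomputable def dZ {d : ℕ} (i : Fin d) (z : Spc d → ℝ) (x : Spc d) : ℝ :=
  fderiv ℝ z x (EuclideanSpace.single i 1)

/-- Divergence `div u = ∑_i ∂_i u_i` of a vector field. -/
noncomputable def divF {d : ℕ} (u : SpT d → Spc d) (p : SpT d) : ℝ :=
  ∑ i, dX i (fun q => u q i) p

/-- Divergence `div (f v) = ∑_i ∂_i (v_i f)` of a scalar multiple of a vector field. -/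
noncomputable def divSV {d : ℕ} (v : SpT d → Spc d) (f : SpT d → ℝ) (p : SpT d) : ℝ :=
  ∑ i, dX i (fun q => v q i * f q) p

/-- Advection term `v·∇f`. -/
noncomputable def adv {d : ℕ} (v : SpT d → Spc d) (f : SpT d → ℝ) (p : SpT d) : ℝ :=
  ∑ i, v p i * dX i f p

/-- `v·∇z` for the (time-independent) bathymetry `z`. -/
noncomputable def advZ {d : ℕ} (v : SpT d → Spc d) (z : Spc d → ℝ) (p : SpT d) : ℝ :=
  ∑ i, v p i * dZ i z p.1

open MeasureTheory

lemma hasDerivAt_line {d : ℕ} {f : SpT d → ℝ} {p : SpT d} (hf : DifferentiableAt ℝ f p)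
    (w : SpT d) : HasDerivAt (fun r : ℝ => f (p + r • w)) (fderiv ℝ f p w) 0 :=
  hf.hasFDerivAt.hasLineDerivAt w

lemma dT_eq_fderiv {d : ℕ} {f : SpT d → ℝ} {p : SpT d} (hf : DifferentiableAt ℝ f p) :
    dT f p = fderiv ℝ f p (0, 1) := by
  have hline : HasDerivAt (fun t : ℝ => ((p.1, t) : SpT d)) (0, 1) p.2 :=
    (hasDerivAt_const _ _).prodMk (hasDerivAt_id _)
  exact (hf.hasFDerivAt.comp_hasDerivAt p.2 hline).deriv

lemma dX_eq_fderiv {d : ℕ} {f : SpT d → ℝ} {p : SpT d} (hf : DifferentiableAt ℝ f p)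
    (i : Fin d) : dX i f p = fderiv ℝ f p (EuclideanSpace.single i 1, 0) := by
  have hslice : HasFDerivAt (fun x : Spc d => ((x, p.2) : SpT d))
      (ContinuousLinearMap.inl ℝ (Spc d) ℝ) p.1 := by
    exact (hasFDerivAt_id _).prodMk (hasFDerivAt_const _ _)
  have := (HasFDerivAt.comp p.1 (g := f) (f := fun x : Spc d => ((x, p.2) : SpT d))
    hf.hasFDerivAt hslice).fderiv
  simp only [dX]
  change fderiv ℝ (f ∘ fun x : Spc d => ((x, p.2) : SpT d)) p.1 _ = _
  rw [this]
  simp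

lemma euclidean_eq_sum_single {d : ℕ} (x : Spc d) :
    x = ∑ i, x i • EuclideanSpace.single i (1 : ℝ) := by
  ext j
  simp [Pi.single_apply]

lemma divSV_eq {d : ℕ} {u : SpT d → Spc d} {f : SpT d → ℝ} {p : SpT d}
    (hf : DifferentiableAt ℝ f p) (hu : ∀ i, DifferentiableAt ℝ (fun q => u q i) p) :
    divSV u f p = adv u f p + f p * divF u p := by
  rw [divSV, adv, divF, Finset.mul_sum, ← Finset.sum_add_distrib]
  refine Finset.sum_congr rfl fun i _ => ?_
  rw [dX_eq_fderiv ((hu i).fun_mul hf), dX_eq_fderiv (hu i), dX_eq_fderiv hf,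
    fderiv_fun_mul (hu i) hf]
  simp

/-- The conservative transport operator in terms of the material derivative, which is the
directional derivative along `(u, 1)`. -/
lemma dT_add_divSV {d : ℕ} {u : SpT d → Spc d} {f : SpT d → ℝ} {p : SpT d}
    (hf : DifferentiableAt ℝ f p) (hu : ∀ i, DifferentiableAt ℝ (fun q => u q i) p) :
    dT f p + divSV u f p = fderiv ℝ f p (u p, 1) + f p * divF u p := by
  have hdir : ((u p, 1) : SpT d)
      = (0, 1) + ∑ i, u p i • ((EuclideanSpace.single i 1, 0) : SpT d) := by
    refine Prod.ext ?_ ?_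
    · simpa [Prod.fst_sum] using euclidean_eq_sum_single (u p)
    · simp [Prod.snd_sum]
  rw [divSV_eq hf hu, hdir, map_add, map_sum, dT_eq_fderiv hf, adv]
  simp only [dX_eq_fderiv hf, map_smul, smul_eq_mul]
  ring

lemma fderiv_bathymetry {d : ℕ} {z : Spc d → ℝ} {p : SpT d} (hz : DifferentiableAt ℝ z p.1)
    (u : SpT d → Spc d) (s : ℝ) :
    fderiv ℝ (fun q : SpT d => z q.1) p (u p, s) = advZ u z p := by
  have hc := (HasFDerivAt.comp p (g := z) (f := Prod.fst) hz.hasFDerivAt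
    (hasFDerivAt_fst (𝕜 := ℝ))).fderiv
  change fderiv ℝ (z ∘ Prod.fst) p (u p, s) = _
  rw [hc]
  simp only [ContinuousLinearMap.comp_apply, ContinuousLinearMap.coe_fst', advZ, dZ]
  conv_lhs => rw [euclidean_eq_sum_single (u p)]
  simp

/-- Coordinates `(t, x₁, …, x_d)` on space-time. -/
def spaceTimeCoords (d : ℕ) : (Fin (d + 1) → ℝ) →L[ℝ] SpT d :=
  ((EuclideanSpace.equiv (Fin d) ℝ).symm.toContinuousLinearMap.comp
    (ContinuousLinearMap.pi fun i : Fin d => ContinuousLinearMap.proj i.succ)).prod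
      (ContinuousLinearMap.proj 0)

@[simp] lemma spaceTimeCoords_fst_apply {d : ℕ} (y : Fin (d + 1) → ℝ) (i : Fin d) :
    (spaceTimeCoords d y).1 i = y i.succ := rfl

@[simp] lemma spaceTimeCoords_snd {d : ℕ} (y : Fin (d + 1) → ℝ) :
    (spaceTimeCoords d y).2 = y 0 := rfl

lemma spaceTimeCoords_single_zero (d : ℕ) :
    spaceTimeCoords d (Pi.single 0 1) = (0, 1) := by
  refine Prod.ext ?_ ?_
  · ext i
    simp
  · simp

lemma spaceTimeCoords_single_succ {d : ℕ} (i : Fin d) :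
    spaceTimeCoords d (Pi.single i.succ 1) = (EuclideanSpace.single i 1, 0) := by
  refine Prod.ext ?_ ?_
  · ext j
    simp [Pi.single_apply]
  · simp

lemma spaceTimeCoords_insertNth_zero {d : ℕ} (t : ℝ) (x : Fin d → ℝ) :
    spaceTimeCoords d ((0 : Fin (d + 1)).insertNth t x) = (WithLp.toLp 2 x, t) := by
  refine Prod.ext ?_ ?_
  · ext j
    simp
  · simp

lemma setIntegral_box_eq {d : ℕ} (a b : Fin d → ℝ) (f : Spc d → ℝ) :
    ∫ x in {x : Spc d | ∀ i, x i ∈ Set.Ioo (a i) (b i)}, f x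
      = ∫ x in Set.Icc a b, f (WithLp.toLp 2 x) := by
  rw [← (PiLp.volume_preserving_toLp (Fin d)).setIntegral_preimage_emb
    (MeasurableEquiv.toLp 2 (Fin d → ℝ)).measurableEmbedding,
    ← setIntegral_congr_set (μ := volume) (Measure.univ_pi_Ioo_ae_eq_Icc (f := a) (g := b))]
  congr 2
  ext x
  simp

/-- A density whose balance law over a box has a nonpositive source and no boundary flux has
nonincreasing total mass. -/
lemma setIntegral_le_of_balance_nonpos {d : ℕ} {E : SpT d → ℝ} {F : SpT d → Spc d}
    (hE : ContDiff ℝ 1 E) (hF : ∀ i, ContDiff ℝ 1 (fun p => F p i))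
    {T : ℝ} (hT : 0 < T) {a b : Fin d → ℝ} (hab : ∀ i, a i < b i)
    (hbal : ∀ p : SpT d, (∀ i, p.1 i ∈ Set.Ioo (a i) (b i)) → 0 < p.2 → p.2 < T →
      dT E p + divF F p ≤ 0)
    (bdry : ∀ t ∈ Set.Ioo (0:ℝ) T, ∀ x : Spc d, (∀ i, x i ∈ Set.Icc (a i) (b i)) →
      ∀ i : Fin d, (x i = a i ∨ x i = b i) → F (x, t) i = 0) :
    ∫ x in {x : Spc d | ∀ i, x i ∈ Set.Ioo (a i) (b i)}, E (x, T)
      ≤ ∫ x in {x : Spc d | ∀ i, x i ∈ Set.Ioo (a i) (b i)}, E (x, 0) := by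
  set A : Fin (d + 1) → ℝ := Fin.cons 0 a
  set B : Fin (d + 1) → ℝ := Fin.cons T b
  have hAB : ∀ i, A i < B i := Fin.cases hT hab
  set G : Fin (d + 1) → SpT d → ℝ := Fin.cons E (fun i p => F p i)
  have hGsm : ∀ i, ContDiff ℝ 1 (G i) := Fin.cases hE hF
  have hderiv : ∀ i y, HasFDerivAt (fun y => G i (spaceTimeCoords d y))
      ((fderiv ℝ (G i) (spaceTimeCoords d y)).comp (spaceTimeCoords d)) y := fun i y =>
    HasFDerivAt.comp y (((hGsm i).differentiable one_ne_zero) _).hasFDerivAt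
      (spaceTimeCoords d).hasFDerivAt
  have hdiv : ∀ y, ∑ i, ((fderiv ℝ (G i) (spaceTimeCoords d y)).comp (spaceTimeCoords d))
      (Pi.single i 1) = dT E (spaceTimeCoords d y) + divF F (spaceTimeCoords d y) := by
    intro y
    rw [Fin.sum_univ_succ, divF, dT_eq_fderiv (hE.differentiable one_ne_zero _)]
    simp only [ContinuousLinearMap.comp_apply, spaceTimeCoords_single_zero,
      spaceTimeCoords_single_succ]
    congr 1
    refine Finset.sum_congr rfl fun i _ => ?_
    rw [dX_eq_fderiv ((hF i).differentiable one_ne_zero _)]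
    rfl
  have hcont : Continuous fun y => ∑ i,
      ((fderiv ℝ (G i) (spaceTimeCoords d y)).comp (spaceTimeCoords d)) (Pi.single i 1) := by
    refine continuous_finsetSum _ fun i _ => ?_
    exact (((hGsm i).continuous_fderiv one_ne_zero).comp
      (spaceTimeCoords d).continuous).clm_apply continuous_const
  have key := integral_divergence_of_hasFDerivAt_off_countable' A B (fun i => (hAB i).le)
    (fun i y => G i (spaceTimeCoords d y))
    (fun i y => (fderiv ℝ (G i) (spaceTimeCoords d y)).comp (spaceTimeCoords d)) ∅
    Set.countable_empty
    (fun i => ((hGsm i).continuous.comp (spaceTimeCoords d).continuous).continuousOn)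
    (fun y _ i => hderiv i y) (hcont.continuousOn.integrableOn_compact isCompact_Icc)
  have hneg : ∫ y in Set.Icc A B, ∑ i,
      ((fderiv ℝ (G i) (spaceTimeCoords d y)).comp (spaceTimeCoords d)) (Pi.single i 1) ≤ 0 := by
    rw [← setIntegral_congr_set (μ := volume) (Measure.univ_pi_Ioo_ae_eq_Icc (f := A) (g := B))]
    refine setIntegral_nonpos (MeasurableSet.univ_pi fun i => measurableSet_Ioo) fun y hy => ?_
    rw [hdiv y]
    have hy' : ∀ i, y i ∈ Set.Ioo (A i) (B i) := fun i => hy i trivial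
    exact hbal _ (fun i => hy' i.succ) (hy' 0).1 (hy' 0).2
  have hside : ∀ (i : Fin d) (c : ℝ), (c = a i ∨ c = b i) →
      ∫ x in Set.Icc (A ∘ i.succ.succAbove) (B ∘ i.succ.succAbove),
        G i.succ (spaceTimeCoords d (i.succ.insertNth c x)) = 0 := by
    intro i c hc
    rw [← setIntegral_congr_set (μ := volume) (Measure.univ_pi_Ioo_ae_eq_Icc
      (f := A ∘ i.succ.succAbove) (g := B ∘ i.succ.succAbove))]
    refine setIntegral_eq_zero_of_forall_eq_zero fun x hx => ?_
    set y : Fin (d + 1) → ℝ := i.succ.insertNth c x with hy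
    have hyi : y i.succ = c := by simp [hy]
    have hyo : ∀ k, k ≠ i.succ → y k ∈ Set.Ioo (A k) (B k) := by
      intro k hk
      obtain ⟨j, rfl⟩ := Fin.exists_succAbove_eq hk
      simpa [hy] using hx j trivial
    refine bdry _ (hyo 0 (Fin.succ_ne_zero i).symm) _ (fun j => ?_) i (by simpa [hyi] using hc)
    change y j.succ ∈ Set.Icc (a j) (b j)
    by_cases hj : j = i
    · subst hj
      rw [hyi]
      rcases hc with rfl | rfl
      · exact Set.left_mem_Icc.2 (hab j).le
      · exact Set.right_mem_Icc.2 (hab j).le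
    · exact Set.Ioo_subset_Icc_self (hyo j.succ (by simpa using hj))
  rw [Fin.sum_univ_succ, Finset.sum_eq_zero (fun i _ => by
    rw [hside i (B i.succ) (Or.inr rfl), hside i (A i.succ) (Or.inl rfl), sub_zero]), add_zero] at key
  simp only [spaceTimeCoords_insertNth_zero] at key
  rw [setIntegral_box_eq a b fun x => E (x, T), setIntegral_box_eq a b fun x => E (x, 0)]
  have hkey' : ∫ y in Set.Icc A B, ∑ i,
      ((fderiv ℝ (G i) (spaceTimeCoords d y)).comp (spaceTimeCoords d)) (Pi.single i 1)
      = (∫ x in Set.Icc a b, E (WithLp.toLp 2 x, T))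
        - ∫ x in Set.Icc a b, E (WithLp.toLp 2 x, 0) := key
  linarith

/-- Derivative along a curve of the energy density (without its constant bathymetry part). -/
lemma hasDerivAt_energy {d : ℕ} {g c : ℝ} {Γ : ℝ → ℝ} (hΓ : Differentiable ℝ Γ)
    {h η ω β ζ : ℝ → ℝ} {u : Fin d → ℝ → ℝ} {h' η' ω' β' ζ' : ℝ} {u' : Fin d → ℝ} {r : ℝ}
    (hh : HasDerivAt h h' r) (hη : HasDerivAt η η' r) (hω : HasDerivAt ω ω' r)
    (hβ : HasDerivAt β β' r) (hζ : HasDerivAt ζ ζ' r) (hu : ∀ i, HasDerivAt (u i) (u' i) r)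
    (h0 : h r ≠ 0) :
    HasDerivAt (fun s => (1/2) * g * (h s + ζ s)^2 + (1/2) * h s * (∑ i, (u i s)^2)
      + (1/6) * h s * (ω s)^2 + (1/8) * h s * (β s)^2
      + c * (h s)^3 * Γ (η s / h s) - (1/2) * g * (ζ s)^2)
      (g * (h r + ζ r) * (h' + ζ') + (1/2) * h' * (∑ i, (u i r)^2)
        + h r * (∑ i, u i r * u' i)
        + (1/6) * h' * (ω r)^2 + (1/3) * h r * ω r * ω'
        + (1/8) * h' * (β r)^2 + (1/4) * h r * β r * β'
        + c * (3 * (h r)^2 * h' * Γ (η r / h r)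
          + h r * deriv Γ (η r / h r) * (η' * h r - η r * h')) - g * ζ r * ζ') r := by
  have hsum : HasDerivAt (fun s => ∑ i, (u i s)^2) (∑ i, 2 * (u i r * u' i)) r := by
    refine HasDerivAt.fun_sum fun i _ => ?_
    exact ((hu i).pow 2).congr_deriv (by push_cast; ring)
  rw [← Finset.mul_sum] at hsum
  have hcomp := (hΓ (η r / h r)).hasDerivAt.comp r (hη.div hh h0)
  have := (((((((hh.add hζ).pow 2).const_mul ((1/2) * g)).add
    ((hh.const_mul (1/2)).mul hsum)).add ((hh.const_mul (1/6)).mul (hω.pow 2))).add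
    ((hh.const_mul (1/8)).mul (hβ.pow 2))).add (((hh.pow 3).const_mul c).mul hcomp)).sub
    ((hζ.pow 2).const_mul ((1/2) * g))
  refine this.congr_deriv ?_
  simp only [Pi.add_apply, Pi.pow_apply, Pi.div_apply, Function.comp_apply]
  field_simp
  push_cast
  ring

/-- The algebra behind the energy balance: primes are material derivatives, `δ` is the divergence
of the velocity, `π` and `σ` are the gradients of pressure and bathymetry. -/
lemma energy_balance_algebra {d : ℕ} {g c h η ω β ζ h' η' ω' β' δ G G' s ts pr r : ℝ}
    {u u' π σ : Fin d → ℝ}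
    (hs : s = 3 * c * h^2 * G')
    (hp : pr = (1/2) * g * h^2 - c * h^2 * (η * G' - 2 * h * G))
    (hr : r = g * h - (1/2) * s + (1/4) * ts)
    (mass : h' + h * δ = 0)
    (momentum : ∀ i, h' * u i + h * u' i + h * u i * δ + π i + r * σ i = 0)
    (eq₁ : h' * η + h * η' + h * η * δ = h * ω - (3/2) * (h * ∑ i, u i * σ i))
    (eq₂ : h' * ω + h * ω' + h * ω * δ = -s)
    (eq₃ : h' * β + h * β' + h * β * δ = ts) :
    (g * (h + ζ) * (h' + ∑ i, u i * σ i) + (1/2) * h' * (∑ i, (u i)^2) + h * (∑ i, u i * u' i)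
        + (1/6) * h' * ω^2 + (1/3) * h * ω * ω' + (1/8) * h' * β^2 + (1/4) * h * β * β'
        + c * (3 * h^2 * h' * G + h * G' * (η' * h - η * h')) - g * ζ * ∑ i, u i * σ i)
      + ((1/2) * g * (h + ζ)^2 + (1/2) * h * (∑ i, (u i)^2) + (1/6) * h * ω^2 + (1/8) * h * β^2
        + c * h^3 * G - (1/2) * g * ζ^2) * δ
      + ((∑ i, u i * π i) + pr * δ)
      = -(1/4) * (ts * ((∑ i, u i * σ i) - β)) := by
  obtain rfl : h' = -h * δ := by linarith
  have hmom : h * (∑ i, u i * u' i) + (∑ i, u i * π i) + r * (∑ i, u i * σ i) = 0 := by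
    simp only [Finset.mul_sum, ← Finset.sum_add_distrib]
    refine Finset.sum_eq_zero fun i _ => ?_
    linear_combination u i * momentum i
  subst hs hp hr
  linear_combination hmom + c * h * G' * eq₁ + (1/3) * ω * eq₂ + (1/4) * β * eq₃

lemma dissipation_nonneg {Φ : ℝ → ℝ} (hΦ : ∀ ξ : ℝ, 0 ≤ ξ * Φ ξ) {k s : ℝ} (hk : 0 ≤ k)
    (hs : 0 < s) (x : ℝ) : 0 ≤ k * Φ (x / s) * x := by
  have := mul_nonneg (mul_nonneg hk hs.le) (hΦ (x / s))
  have hx : x = s * (x / s) := by field_simp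
  calc 0 ≤ k * s * (x / s * Φ (x / s)) := this
    _ = k * Φ (x / s) * (s * (x / s)) := by ring
    _ = k * Φ (x / s) * x := by rw [← hx]

/-- For a smooth solution of the relaxed Serre--Green--Naghdi system on a
bounded box `D` with vanishing boundary flux `F_ε·n = 0` on `∂D`, the quantity
`∫_D h³ Γ(η/h) dx` at `t = T` is bounded by `c(u₀) ε` with
`c(u₀) = (3/(λ̄ g)) ∫_D E_ε(·,0) dx`. -/
theorem relaxed_sgn_relaxation_estimate
    {d : ℕ} (g h₀ ε lam : ℝ) (hg : 0 < g) (hh₀ : 0 < h₀) (hε : 0 < ε) (hlam : 0 < lam)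
    (z : Spc d → ℝ) (zsm : ContDiff ℝ (⊤ : ℕ∞) z)
    -- relaxation functions `Γ` and `Φ`
    (Γ : ℝ → ℝ) (hΓsm : ContDiff ℝ 2 Γ) (hΓnonneg : ∀ x, 0 ≤ Γ x)
    (hΓ1 : Γ 1 = 0) (hΓ'1 : deriv Γ 1 = 0)
    (Φ : ℝ → ℝ) (hΦcont : Continuous Φ) (hΦsign : ∀ ξ : ℝ, 0 ≤ ξ * Φ ξ)
    -- the unknowns
    (h : SpT d → ℝ) (Q : SpT d → Spc d) (q₁ q₂ q₃ : SpT d → ℝ)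
    (hsm : ContDiff ℝ (⊤ : ℕ∞) h) (Qsm : ContDiff ℝ (⊤ : ℕ∞) Q)
    (q₁sm : ContDiff ℝ (⊤ : ℕ∞) q₁) (q₂sm : ContDiff ℝ (⊤ : ℕ∞) q₂) (q₃sm : ContDiff ℝ (⊤ : ℕ∞) q₃)
    (hpos : ∀ p : SpT d, 0 < h p)
    (v : SpT d → Spc d) (hv : ∀ p, v p = (h p)⁻¹ • Q p)
    (η ω β : SpT d → ℝ)
    (hη : ∀ p, η p = q₁ p / h p) (hω : ∀ p, ω p = q₂ p / h p) (hβ : ∀ p, β p = q₃ p / h p)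
    -- relaxation sources and relaxed pressure
    (sε tsε tpε pε rε : SpT d → ℝ)
    (hsε : ∀ p, sε p = lam * g * ((h p)^2 / ε) * deriv Γ (η p / h p))
    (htsε : ∀ p, tsε p = lam * g * h₀ * (h p / ε) * Φ ((advZ v z p - β p) / Real.sqrt (g * h₀)))
    (htpε : ∀ p, tpε p = -(1/3) * (lam * g / ε) * (h p)^2
        * (η p * deriv Γ (η p / h p) - 2 * h p * Γ (η p / h p)))
    (hpε : ∀ p, pε p = (1/2) * g * (h p)^2 + tpε p)
    (hrε : ∀ p, rε p = g * h p - (1/2) * sε p + (1/4) * tsε p)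
    -- the bounded box `D = ∏_i (a i, b i)` and the final time `T`
    (T : ℝ) (hT : 0 < T)
    (a b : Fin d → ℝ) (hab : ∀ i, a i < b i)
    (D : Set (Spc d)) (hD : D = {x : Spc d | ∀ i, x i ∈ Set.Ioo (a i) (b i)})
    -- the relaxed system on `D × (0,T)`
    (mass : ∀ p : SpT d, p.1 ∈ D → 0 < p.2 → p.2 < T → dT h p + divF Q p = 0)
    (momentum : ∀ p : SpT d, p.1 ∈ D → 0 < p.2 → p.2 < T → ∀ i : Fin d,
      dT (fun q => Q q i) p + (∑ j, dX j (fun q => v q j * Q q i) p)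
        + dX i pε p + rε p * dZ i z p.1 = 0)
    (eqq₁ : ∀ p : SpT d, p.1 ∈ D → 0 < p.2 → p.2 < T →
      dT q₁ p + divSV v q₁ p = q₂ p - (3/2) * (∑ i, Q p i * dZ i z p.1))
    (eqq₂ : ∀ p : SpT d, p.1 ∈ D → 0 < p.2 → p.2 < T → dT q₂ p + divSV v q₂ p = -(sε p))
    (eqq₃ : ∀ p : SpT d, p.1 ∈ D → 0 < p.2 → p.2 < T → dT q₃ p + divSV v q₃ p = tsε p)
    -- relaxed energy and energy flux
    (Eε : SpT d → ℝ)
    (hEε : ∀ p, Eε p = (1/2) * g * (h p + z p.1)^2 + (1/2) * h p * (∑ i, (v p i)^2)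
      + (1/6) * h p * (ω p)^2 + (1/8) * h p * (β p)^2
      + (lam * g / (3 * ε)) * (h p)^3 * Γ (η p / h p))
    (Fε : SpT d → Spc d)
    (hFε : ∀ p, ∀ i : Fin d, Fε p i = v p i * (Eε p - (1/2) * g * (z p.1)^2 + pε p))
    -- vanishing boundary flux `F_ε·n = 0` on `∂D` for all `t ∈ (0,T)`:
    -- on the face `{x i = a i}` or `{x i = b i}` the `i`-th component of `F_ε` vanishes
    (bdry : ∀ t ∈ Set.Ioo (0:ℝ) T, ∀ x : Spc d, (∀ i, x i ∈ Set.Icc (a i) (b i)) →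
      ∀ i : Fin d, (x i = a i ∨ x i = b i) → Fε (x, t) i = 0) :
    ∫ x in D, (h (x, T))^3 * Γ (η (x, T) / h (x, T))
      ≤ ((3 / (lam * g)) * ∫ x in D, Eε (x, 0)) * ε := by
  have hne : ∀ p, h p ≠ 0 := fun p => (hpos p).ne'
  have h1 : (1 : WithTop ℕ∞) ≤ ((⊤ : ℕ∞) : WithTop ℕ∞) := by exact_mod_cast le_top
  have hC : ContDiff ℝ 1 h := hsm.of_le h1
  have QC : ∀ i, ContDiff ℝ 1 (fun p => Q p i) := fun i => (contDiff_euclidean.1 Qsm i).of_le h1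
  have hvi : ∀ p i, v p i = Q p i / h p := fun p i => by
    rw [hv, PiLp.smul_apply, smul_eq_mul, inv_mul_eq_div]
  have hQv : ∀ p i, Q p i = v p i * h p := fun p i => by
    rw [hvi, div_mul_cancel₀ _ (hne p)]
  have vC : ∀ i, ContDiff ℝ 1 (fun p => v p i) := fun i => by
    simp only [hvi]
    exact (QC i).div hC hne
  have ηC : ContDiff ℝ 1 η := by
    rw [funext hη]
    exact (q₁sm.of_le h1).div hC hne
  have ωC : ContDiff ℝ 1 ω := by
    rw [funext hω]
    exact (q₂sm.of_le h1).div hC hne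
  have βC : ContDiff ℝ 1 β := by
    rw [funext hβ]
    exact (q₃sm.of_le h1).div hC hne
  have zC : ContDiff ℝ 1 (fun p : SpT d => z p.1) := (zsm.of_le h1).comp contDiff_fst
  have ηhC : ContDiff ℝ 1 (fun p => η p / h p) := ηC.div hC hne
  have ΓC : ContDiff ℝ 1 (fun p => Γ (η p / h p)) := (hΓsm.of_le one_le_two).comp ηhC
  have Γ'C : ContDiff ℝ 1 (fun p => deriv Γ (η p / h p)) :=
    (contDiff_succ_iff_deriv.1 (hΓsm : ContDiff ℝ (1 + 1) Γ)).2.2.comp ηhC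
  have pC : ContDiff ℝ 1 pε := by
    rw [funext hpε]
    simp only [htpε]
    exact (contDiff_const.mul (hC.pow 2)).add ((contDiff_const.mul (hC.pow 2)).mul
      ((ηC.mul Γ'C).sub ((contDiff_const.mul hC).mul ΓC)))
  have EC : ContDiff ℝ 1 Eε := by
    rw [funext hEε]
    exact ((((contDiff_const.mul ((hC.add zC).pow 2)).add
      ((contDiff_const.mul hC).mul (ContDiff.sum fun i _ => (vC i).pow 2))).add
      ((contDiff_const.mul hC).mul (ωC.pow 2))).add
      ((contDiff_const.mul hC).mul (βC.pow 2))).add ((contDiff_const.mul (hC.pow 3)).mul ΓC)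
  have FC : ∀ i, ContDiff ℝ 1 (fun p => Fε p i) := fun i => by
    have := vC i
    simp only [hFε]
    fun_prop
  have diff {f : SpT d → ℝ} (hf : ContDiff ℝ 1 f) (p : SpT d) : DifferentiableAt ℝ f p :=
    hf.differentiable one_ne_zero p
  have hbal : ∀ p : SpT d, (∀ i, p.1 i ∈ Set.Ioo (a i) (b i)) → 0 < p.2 → p.2 < T →
      dT Eε p + divF Fε p ≤ 0 := by
    intro p hpD hp0 hpT
    replace hpD : p.1 ∈ D := by rw [hD]; exact hpD
    have vd : ∀ i, DifferentiableAt ℝ (fun q => v q i) p := fun i => diff (vC i) p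
    -- conservative transport of `h f` in terms of material derivatives
    have transport {f : SpT d → ℝ} (hf : ContDiff ℝ 1 f) :
        dT (fun q => h q * f q) p + divSV v (fun q => h q * f q) p
          = fderiv ℝ h p (v p, 1) * f p + h p * fderiv ℝ f p (v p, 1)
            + h p * f p * divF v p := by
      rw [dT_add_divSV (diff (hC.mul hf) p) vd, fderiv_fun_mul (diff hC p) (diff hf p)]
      simp
      ring
    have massD : fderiv ℝ h p (v p, 1) + h p * divF v p = 0 := by
      rw [← dT_add_divSV (diff hC p) vd, ← mass p hpD hp0 hpT]
      simp only [divF, divSV, hQv]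
    have momD : ∀ i, fderiv ℝ h p (v p, 1) * v p i
        + h p * fderiv ℝ (fun q => v q i) p (v p, 1) + h p * v p i * divF v p
        + dX i pε p + rε p * dZ i z p.1 = 0 := by
      intro i
      rw [← transport (vC i), ← momentum p hpD hp0 hpT i]
      simp only [divSV, hQv, mul_comm (h _)]
    have e₁ : q₁ = fun q => h q * η q := funext fun q => by rw [hη, mul_div_cancel₀ _ (hne q)]
    have e₂ : q₂ = fun q => h q * ω q := funext fun q => by rw [hω, mul_div_cancel₀ _ (hne q)]
    have e₃ : q₃ = fun q => h q * β q := funext fun q => by rw [hβ, mul_div_cancel₀ _ (hne q)]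
    have eq₁D := eqq₁ p hpD hp0 hpT
    rw [e₁, transport ηC, e₂] at eq₁D
    have eq₂D := eqq₂ p hpD hp0 hpT
    rw [e₂, transport ωC] at eq₂D
    have eq₃D := eqq₃ p hpD hp0 hpT
    rw [e₃, transport βC] at eq₃D
    have hQz : ∑ i, Q p i * dZ i z p.1 = h p * ∑ i, v p i * dZ i z p.1 := by
      rw [Finset.mul_sum]
      exact Finset.sum_congr rfl fun i _ => by rw [hQv]; ring
    rw [hQz] at eq₁D
    have alg := energy_balance_algebra (g := g) (c := lam * g / (3 * ε)) (ζ := z p.1)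
      (G := Γ (η p / h p)) (G' := deriv Γ (η p / h p)) (pr := pε p)
      (by rw [hsε]; field_simp) (by rw [hpε, htpε]; field_simp; ring) (hrε p)
      massD momD eq₁D eq₂D eq₃D
    -- the energy density without the constant bathymetry part
    set W : SpT d → ℝ := fun q => Eε q - (1/2) * g * (z q.1)^2 with hW
    have WC : ContDiff ℝ 1 W := by fun_prop
    have hWD : fderiv ℝ W p (v p, 1) = _ :=
      (hasDerivAt_line (diff WC p) (v p, 1)).unique <| by
        have := hasDerivAt_energy (g := g) (c := lam * g / (3 * ε))
          (hΓsm.differentiable two_ne_zero)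
          (hasDerivAt_line (diff hC p) (v p, 1)) (hasDerivAt_line (diff ηC p) (v p, 1))
          (hasDerivAt_line (diff ωC p) (v p, 1)) (hasDerivAt_line (diff βC p) (v p, 1))
          (hasDerivAt_line (diff zC p) (v p, 1))
          (fun i => hasDerivAt_line (vd i) (v p, 1)) (hne _)
        simpa only [hW, hEε] using this
    rw [fderiv_bathymetry (zsm.differentiable (by simp) p.1) v 1] at hWD
    simp only [zero_smul, add_zero, advZ] at hWD
    have hbalance : dT Eε p + divF Fε p
        = -(1/4) * (tsε p * ((∑ i, v p i * dZ i z p.1) - β p)) := by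
      have hdT : dT Eε p = dT W p := by simp [dT, hW]
      have hdiv : divF Fε p = divSV v W p + divSV v pε p := by
        have hsplit : divF Fε p = divSV v (fun q => W q + pε q) p := by
          simp only [divF, divSV, hFε, hW]
        rw [hsplit, divSV_eq (diff (WC.add pC) p) vd, divSV_eq (diff WC p) vd,
          divSV_eq (diff pC p) vd]
        have hadv : adv v (fun q => W q + pε q) p = adv v W p + adv v pε p := by
          simp only [adv, ← Finset.sum_add_distrib]
          refine Finset.sum_congr rfl fun i _ => ?_
          rw [dX_eq_fderiv (diff (WC.add pC) p), dX_eq_fderiv (diff WC p),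
            dX_eq_fderiv (diff pC p), fderiv_fun_add (diff WC p) (diff pC p)]
          simp
          ring
        rw [hadv]
        ring
      rw [hdT, hdiv, ← add_assoc, dT_add_divSV (diff WC p) vd, divSV_eq (diff pC p) vd, hWD,
        ← alg]
      simp only [hW, hEε, adv]
    rw [hbalance, htsε, advZ]
    have := dissipation_nonneg hΦsign
      (mul_nonneg (mul_pos (mul_pos hlam hg) hh₀).le (div_pos (hpos p) hε).le)
      (Real.sqrt_pos.2 (mul_pos hg hh₀)) ((∑ i, v p i * dZ i z p.1) - β p)
    linarith
  have hmono := setIntegral_le_of_balance_nonpos EC FC hT hab hbal bdry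
  rw [← hD] at hmono
  have hint {f : SpT d → ℝ} (hf : ContDiff ℝ 1 f) : IntegrableOn (fun x => f (x, T)) D := by
    have hK : IsCompact ((EuclideanSpace.equiv (Fin d) ℝ) ⁻¹' Set.Icc a b) :=
      (EuclideanSpace.equiv (Fin d) ℝ).toHomeomorph.isCompact_preimage.2 isCompact_Icc
    have hc : Continuous fun x => f (x, T) := hf.continuous.comp (by fun_prop)
    refine (hc.continuousOn.integrableOn_compact hK).mono_set ?_
    rw [hD]
    exact fun x hx => ⟨fun i => (hx i).1.le, fun i => (hx i).2.le⟩
  have hc : 0 < 3 * ε / (lam * g) := by positivity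
  have hle : ∫ x in D, (h (x, T))^3 * Γ (η (x, T) / h (x, T))
      ≤ ∫ x in D, 3 * ε / (lam * g) * Eε (x, T) := by
    refine integral_mono (hint ((hC.pow 3).mul ΓC)) ((hint EC).const_mul _) fun x => ?_
    have hpx := hpos (x, T)
    have hrest : lam * g / (3 * ε) * ((h (x, T))^3 * Γ (η (x, T) / h (x, T))) ≤ Eε (x, T) := by
      rw [hEε, ← mul_assoc]
      refine le_add_of_nonneg_left ?_
      positivity
    calc (h (x, T))^3 * Γ (η (x, T) / h (x, T))
        = 3 * ε / (lam * g)
          * (lam * g / (3 * ε) * ((h (x, T))^3 * Γ (η (x, T) / h (x, T)))) := by field_simp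
      _ ≤ _ := mul_le_mul_of_nonneg_left hrest hc.le
  rw [integral_const_mul] at hle
  calc _ ≤ _ := hle
    _ ≤ 3 * ε / (lam * g) * ∫ x in D, Eε (x, 0) := mul_le_mul_of_nonneg_left hmono hc.le
    _ = _ := by ring
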